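/- Let G be a connected compact metric graph with exponents p̄ and nonlinearities γ_e as above, f = (f_e) with f_e ∈ L^1(0,ℓ_e), and ω : V → ℝ. Fix a vertex v₀ ∈ V, and for ε ∈ ℝ let ω^ε : V → ℝ be given by ω^ε(v) = ω(v) for v ≠ v₀ and ω^ε(v₀) = ω(v₀) + ε. Let v_ε = (γ_e ∘ u_{ε,e})_e be the unique weak solution of (P_{ω^ε}^f), with each u_{ε,e} its C¹ representative. Then: u_{0,e} ≤ u_{ε,e} on [0,ℓ_e] for every edge e if ε ≥ 0, and u_{ε,e} ≤ u_{0,e} on [0,ℓ_e] for every edge e if ε ≤ 0; moreover the map ε ↦ u_ε(v₀) (the common vertex value at v₀) is strictly increasing and continuous on ℝ. -/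

import Mathlib

open MeasureTheory Set Filter

noncomputable section

/-- A connected compact metric graph: finite nonempty vertex set, finite edge set,
initial/terminal vertex maps without loops, positive edge lengths, no multiple edges,
and connectedness via paths of edges. -/
structure MetricGraph where
  V : Type
  E : Type
  fintypeV : Fintype V
  fintypeE : Fintype E
  nonemptyV : Nonempty V
  ι : E → V
  τ : E → V
  no_loops : ∀ e, ι e ≠ τ e
  len : E → ℝ
  len_pos : ∀ e, 0 < len e
  no_multi : ∀ e e', ({ι e, τ e} : Set V) = ({ι e', τ e'} : Set V) → e = e'
  connected : ∀ v w : V,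
    Relation.ReflTransGen (fun a b => ∃ e, (ι e = a ∧ τ e = b) ∨ (ι e = b ∧ τ e = a)) v w

/-- Sum over the edges of the graph. -/
def edgeSum (G : MetricGraph) (F : G.E → ℝ) : ℝ :=
  letI := G.fintypeE
  ∑ e, F e

/-- Sum over the vertices of the graph. -/
def vertexSum (G : MetricGraph) (F : G.V → ℝ) : ℝ :=
  letI := G.fintypeV
  ∑ v, F v

/-- Number of vertices. -/
def vertexCard (G : MetricGraph) : ℕ :=
  letI := G.fintypeV
  Fintype.card G.V

/-- ρ_p(r) = |r|^(p-2) r. -/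
def rho (p r : ℝ) : ℝ := |r| ^ (p - 2) * r

/-- `(u, u')` is in the Sobolev space W^{1,p}(0,ℓ): `u'` is integrable with `|u'|^p`
integrable on (0,ℓ), and `u` is absolutely continuous on [0,ℓ] with derivative `u'`. -/
def IntervalSobolev (ℓ p : ℝ) (u u' : ℝ → ℝ) : Prop :=
  IntegrableOn u' (Ioo 0 ℓ) volume ∧
  IntegrableOn (fun x => |u' x| ^ p) (Ioo 0 ℓ) volume ∧
  ∀ x ∈ Icc (0:ℝ) ℓ, u x = u 0 + ∫ t in (0:ℝ)..x, u' t

/-- `(u, u')` is in W^{1,p̄}(G), continuous at the vertices with vertex values `uV`. -/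
def GraphSobolev (G : MetricGraph) (p : G.E → ℝ) (u u' : G.E → ℝ → ℝ) (uV : G.V → ℝ) : Prop :=
  (∀ e, IntervalSobolev (G.len e) (p e) (u e) (u' e)) ∧
  (∀ e, u e 0 = uV (G.ι e)) ∧
  (∀ e, u e (G.len e) = uV (G.τ e))

/-- `v` is a weak solution of the graph problem (P_ω^f) with data `u, u', uV`. -/
def SolvesGraphProblem (G : MetricGraph) (p : G.E → ℝ) (γ : G.E → ℝ → ℝ)
    (f : G.E → ℝ → ℝ) (ω : G.V → ℝ)
    (v : G.E → ℝ → ℝ) (u u' : G.E → ℝ → ℝ) (uV : G.V → ℝ) : Prop :=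
  (∀ e, IntegrableOn (v e) (Ioo 0 (G.len e)) volume) ∧
  GraphSobolev G p u u' uV ∧
  (∀ e, ∀ᵐ x ∂(volume.restrict (Ioo 0 (G.len e))), v e x = γ e (u e x)) ∧
  ∀ φ φ' : G.E → ℝ → ℝ, ∀ φV : G.V → ℝ, GraphSobolev G p φ φ' φV →
    edgeSum G (fun e => ∫ x in Ioo 0 (G.len e), v e x * φ e x)
      + edgeSum G (fun e => ∫ x in Ioo 0 (G.len e), rho (p e) (u' e x) * φ' e x)
    = edgeSum G (fun e => ∫ x in Ioo 0 (G.len e), f e x * φ e x)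
      + vertexSum G (fun w => ω w * φV w)

/-- `v` is a weak solution of the graph problem (P_ω^f). -/
def IsGraphWeakSolution (G : MetricGraph) (p : G.E → ℝ) (γ : G.E → ℝ → ℝ)
    (f : G.E → ℝ → ℝ) (ω : G.V → ℝ) (v : G.E → ℝ → ℝ) : Prop :=
  ∃ u u' uV, SolvesGraphProblem G p γ f ω v u u' uV

/-- `v` is a weak solution of the interval Neumann problem (P^{γ,f}_{p,a,b}),
with associated Sobolev function `u` (derivative `u'`). -/
def SolvesNeumann (ℓ p : ℝ) (γ f : ℝ → ℝ) (a b : ℝ) (v u u' : ℝ → ℝ) : Prop :=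
  IntegrableOn v (Ioo 0 ℓ) volume ∧
  IntervalSobolev ℓ p u u' ∧
  (∀ᵐ x ∂(volume.restrict (Ioo 0 ℓ)), v x = γ (u x)) ∧
  ∀ φ φ' : ℝ → ℝ, IntervalSobolev ℓ p φ φ' →
    (∫ x in Ioo 0 ℓ, v x * φ x) + (∫ x in Ioo 0 ℓ, rho p (u' x) * φ' x)
    = (∫ x in Ioo 0 ℓ, f x * φ x) + a * φ 0 + b * φ ℓ

/-- `v` is a weak solution of the interval Neumann problem (P^{γ,f}_{p,a,b}). -/
def IsNeumannWeakSolution (ℓ p : ℝ) (γ f : ℝ → ℝ) (a b : ℝ) (v : ℝ → ℝ) : Prop :=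
  ∃ u u', SolvesNeumann ℓ p γ f a b v u u'

end

theorem rho_eq_posPart_sub_negPart {p : ℝ} (hp : 1 < p) (r : ℝ) :
    rho p r = (max r 0) ^ (p - 1) - (max (-r) 0) ^ (p - 1) := by
  have hexp : p - 1 = (p - 2) + 1 := by ring
  have h0 : (0 : ℝ) ^ (p - 1) = 0 := Real.zero_rpow (by linarith)
  unfold rho
  rcases lt_trichotomy r 0 with h | h | h
  · rw [max_eq_right h.le, max_eq_left (by linarith), h0, abs_of_neg h, hexp,
      Real.rpow_add_one (by linarith)]
    ring
  · subst h
    simp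
  · rw [max_eq_left h.le, max_eq_right (by linarith), h0, abs_of_pos h, hexp,
      Real.rpow_add_one h.ne']
    ring

theorem continuous_rho {p : ℝ} (hp : 1 < p) : Continuous (rho p) := by
  have h : rho p = fun r => (max r 0) ^ (p - 1) - (max (-r) 0) ^ (p - 1) :=
    funext (rho_eq_posPart_sub_negPart hp)
  have hp' : 0 ≤ p - 1 := by linarith
  rw [h]
  exact ((continuous_id.max continuous_const).rpow_const fun _ => Or.inr hp').sub
    ((continuous_neg.max continuous_const).rpow_const fun _ => Or.inr hp')

theorem strictMono_rho {p : ℝ} (hp : 1 < p) : StrictMono (rho p) := by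
  intro x y hxy
  have hp' : 0 < p - 1 := by linarith
  rw [rho_eq_posPart_sub_negPart hp, rho_eq_posPart_sub_negPart hp]
  rcases lt_or_ge 0 y with hy | hy
  · have h1 : (max x 0) ^ (p - 1) < (max y 0) ^ (p - 1) :=
      Real.rpow_lt_rpow (le_max_right _ _)
        (by rw [max_eq_left hy.le]; exact max_lt hxy hy) hp'
    have h2 : (max (-y) 0) ^ (p - 1) ≤ (max (-x) 0) ^ (p - 1) :=
      Real.rpow_le_rpow (le_max_right _ _) (max_le_max_right 0 (by linarith)) hp'.le
    linarith
  · have h1 : (max x 0) ^ (p - 1) ≤ (max y 0) ^ (p - 1) :=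
      Real.rpow_le_rpow (le_max_right _ _) (max_le_max_right 0 hxy.le) hp'.le
    have h2 : (max (-y) 0) ^ (p - 1) < (max (-x) 0) ^ (p - 1) := by
      refine Real.rpow_lt_rpow (le_max_right _ _) ?_ hp'
      rw [max_eq_left (by linarith : (0 : ℝ) ≤ -x), max_eq_left (by linarith : (0 : ℝ) ≤ -y)]
      linarith
    linarith

theorem Monotone.sub_mul_sub_nonneg {g : ℝ → ℝ} (hg : Monotone g) (a b : ℝ) :
    0 ≤ (g a - g b) * (a - b) := by
  rcases le_total a b with h | h
  · exact mul_nonneg_of_nonpos_of_nonpos (sub_nonpos.2 (hg h)) (sub_nonpos.2 h)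
  · exact mul_nonneg (sub_nonneg.2 (hg h)) (sub_nonneg.2 h)

/-- Quantitative strict monotonicity with one argument in a compact set. -/
theorem StrictMono.exists_abs_sub_le {g : ℝ → ℝ} (hg : StrictMono g) (hc : Continuous g)
    {K : Set ℝ} (hK : IsCompact K) {η : ℝ} (hη : 0 < η) :
    ∃ C : ℝ, 0 ≤ C ∧ ∀ b ∈ K, ∀ a, |a - b| ≤ η + C * ((g a - g b) * (a - b)) := by
  rcases K.eq_empty_or_nonempty with rfl | hne
  · exact ⟨0, le_rfl, by simp⟩
  obtain ⟨b₀, -, hmin⟩ := hK.exists_isMinOn hne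
    (f := fun b => min (g (b + η) - g b) (g b - g (b - η))) (by fun_prop)
  set c := min (g (b₀ + η) - g b₀) (g b₀ - g (b₀ - η))
  have hcpos : 0 < c :=
    lt_min (sub_pos.2 (hg (by linarith))) (sub_pos.2 (hg (by linarith)))
  refine ⟨c⁻¹, by positivity, fun b hb a => ?_⟩
  have hprod := hg.monotone.sub_mul_sub_nonneg a b
  rcases le_or_gt |a - b| η with h | h
  · have : 0 ≤ c⁻¹ * ((g a - g b) * (a - b)) := by positivity
    linarith
  · have hcb : c ≤ min (g (b + η) - g b) (g b - g (b - η)) := hmin hb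
    have hgap : c ≤ |g a - g b| := by
      rcases lt_abs.1 h with h' | h'
      · have := hg.monotone (show b + η ≤ a by linarith)
        exact (hcb.trans (min_le_left _ _)).trans
          ((by linarith : _ ≤ g a - g b).trans (le_abs_self _))
      · have := hg.monotone (show a ≤ b - η by linarith)
        exact (hcb.trans (min_le_right _ _)).trans
          ((by linarith : _ ≤ -(g a - g b)).trans (neg_le_abs _))
    rw [← abs_of_nonneg hprod, abs_mul]
    have : |a - b| ≤ c⁻¹ * (|g a - g b| * |a - b|) := by
      rw [inv_mul_eq_div, le_div_iff₀ hcpos, mul_comm]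
      exact mul_le_mul_of_nonneg_right hgap (abs_nonneg _)
    linarith

theorem setIntegral_Ioo_eq_intervalIntegral {ℓ : ℝ} (hℓ : 0 < ℓ) (g : ℝ → ℝ) :
    ∫ x in Ioo 0 ℓ, g x = ∫ x in (0:ℝ)..ℓ, g x := by
  rw [intervalIntegral.integral_of_le hℓ.le, integral_Ioc_eq_integral_Ioo]

theorem IntervalSobolev.continuousOn {ℓ p : ℝ} {u u' : ℝ → ℝ} (hℓ : 0 < ℓ)
    (h : IntervalSobolev ℓ p u u') : ContinuousOn u (Icc 0 ℓ) := by
  have hi : IntegrableOn u' (Icc 0 ℓ) := by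
    rw [integrableOn_Icc_iff_integrableOn_Ioo]
    exact h.1
  rw [← uIcc_of_le hℓ.le] at hi ⊢
  refine ((continuousOn_const (c := u 0)).add
    (intervalIntegral.continuousOn_primitive_interval hi)).congr ?_
  rw [uIcc_of_le hℓ.le]
  exact h.2.2

theorem IntervalSobolev.hasDerivAt {ℓ p : ℝ} {u u' : ℝ → ℝ}
    (h : IntervalSobolev ℓ p u u') (hc : ContinuousOn u' (Icc 0 ℓ)) {x : ℝ}
    (hx : x ∈ Ioo 0 ℓ) : HasDerivAt u (u' x) x := by
  have hnhds : Icc 0 ℓ ∈ nhds x := Icc_mem_nhds hx.1 hx.2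
  have hint : IntervalIntegrable u' volume 0 x :=
    (hc.mono (Icc_subset_Icc_right hx.2.le)).intervalIntegrable_of_Icc hx.1.le
  have hd := (intervalIntegral.integral_hasDerivAt_right hint
    ((hc.mono Ioo_subset_Icc_self).stronglyMeasurableAtFilter isOpen_Ioo x hx)
    (hc.continuousAt hnhds)).const_add (u 0)
  refine hd.congr_of_eventuallyEq ?_
  filter_upwards [hnhds] with y hy using h.2.2 y hy

theorem IntervalSobolev.of_hasDerivAt {ℓ p : ℝ} {u u' : ℝ → ℝ} (hp : 0 ≤ p)
    (hu : ContinuousOn u (Icc 0 ℓ)) (hu' : ContinuousOn u' (Icc 0 ℓ))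
    (hd : ∀ x ∈ Ioo 0 ℓ, HasDerivAt u (u' x) x) : IntervalSobolev ℓ p u u' := by
  refine ⟨hu'.integrableOn_Icc.mono_set Ioo_subset_Icc_self,
    (hu'.abs.rpow_const fun _ _ => Or.inr hp).integrableOn_Icc.mono_set Ioo_subset_Icc_self,
    fun x hx => ?_⟩
  have hsub : Icc 0 x ⊆ Icc 0 ℓ := Icc_subset_Icc_right hx.2
  rw [intervalIntegral.integral_eq_sub_of_hasDerivAt_of_le hx.1 (hu.mono hsub)
    (fun y hy => hd y ⟨hy.1, hy.2.trans_le hx.2⟩)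
    ((hu'.mono hsub).intervalIntegrable_of_Icc hx.1)]
  ring

/-- The one-dimensional Sobolev inequality bounding a value by the `W^{1,1}` norm. -/
theorem IntervalSobolev.length_mul_abs_le {ℓ p : ℝ} {u u' : ℝ → ℝ} (hℓ : 0 < ℓ)
    (h : IntervalSobolev ℓ p u u') (hc : ContinuousOn u' (Icc 0 ℓ)) {y : ℝ}
    (hy : y ∈ Icc 0 ℓ) : ℓ * |u y| ≤ ∫ x in (0:ℝ)..ℓ, (|u x| + ℓ * |u' x|) := by
  have hint : ∀ {a b}, a ∈ Icc 0 ℓ → b ∈ Icc 0 ℓ → IntervalIntegrable u' volume a b :=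
    fun ha hb => (hc.mono (uIcc_subset_Icc ha hb)).intervalIntegrable
  have h0 : (0:ℝ) ∈ Icc 0 ℓ := left_mem_Icc.2 hℓ.le
  have hucont := h.continuousOn hℓ
  have hiu : IntervalIntegrable (fun x => |u x|) volume 0 ℓ :=
    hucont.abs.intervalIntegrable_of_Icc hℓ.le
  have hiu' : IntervalIntegrable (fun x => |u' x|) volume 0 ℓ :=
    hc.abs.intervalIntegrable_of_Icc hℓ.le
  have hpt : ∀ x ∈ Icc 0 ℓ, |u y| - ∫ t in (0:ℝ)..ℓ, |u' t| ≤ |u x| := by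
    intro x hx
    have hdiff : u y - u x = ∫ t in x..y, u' t := by
      rw [h.2.2 y hy, h.2.2 x hx,
        ← intervalIntegral.integral_add_adjacent_intervals (hint h0 hx) (hint hx hy)]
      ring
    have hle : |∫ t in x..y, u' t| ≤ ∫ t in (0:ℝ)..ℓ, |u' t| := by
      refine (intervalIntegral.norm_integral_le_integral_norm_uIoc (f := u')).trans ?_
      rw [intervalIntegral.integral_of_le hℓ.le]
      refine setIntegral_mono_set hiu'.1 (ae_of_all _ fun _ => abs_nonneg _) ?_
      refine LE.le.eventuallyLE ?_
      exact Ioc_subset_Ioc (le_min hx.1 hy.1) (max_le hx.2 hy.2)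
    have := abs_sub_abs_le_abs_sub (u y) (u x)
    rw [hdiff] at this
    linarith
  have hmono := intervalIntegral.integral_mono_on hℓ.le intervalIntegrable_const hiu hpt
  rw [intervalIntegral.integral_const, smul_eq_mul, sub_zero] at hmono
  rw [intervalIntegral.integral_add hiu (hiu'.const_mul ℓ), intervalIntegral.integral_const_mul]
  linarith

/-- Two solutions with the same `f`, tested against a `C¹` function of their difference. -/
theorem SolvesGraphProblem.sub_tested {G : MetricGraph} {p : G.E → ℝ} (hp : ∀ e, 1 < p e)
    {γ : G.E → ℝ → ℝ} (hγ : ∀ e, Continuous (γ e)) {f : G.E → ℝ → ℝ} {ω₁ ω₂ : G.V → ℝ}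
    {u₁ u₁' u₂ u₂' : G.E → ℝ → ℝ} {uV₁ uV₂ : G.V → ℝ}
    (h₁ : SolvesGraphProblem G p γ f ω₁ (fun e x => γ e (u₁ e x)) u₁ u₁' uV₁)
    (h₂ : SolvesGraphProblem G p γ f ω₂ (fun e x => γ e (u₂ e x)) u₂ u₂' uV₂)
    (hc₁ : ∀ e, ContinuousOn (u₁' e) (Icc 0 (G.len e)))
    (hc₂ : ∀ e, ContinuousOn (u₂' e) (Icc 0 (G.len e)))
    {H H' : ℝ → ℝ} (hH : ∀ t, HasDerivAt H (H' t) t) (hH' : Continuous H') :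
    edgeSum G (fun e => ∫ x in (0:ℝ)..G.len e,
      ((γ e (u₂ e x) - γ e (u₁ e x)) * H (u₂ e x - u₁ e x)
        + (rho (p e) (u₂' e x) - rho (p e) (u₁' e x))
          * (H' (u₂ e x - u₁ e x) * (u₂' e x - u₁' e x))))
      = vertexSum G (fun w => (ω₂ w - ω₁ w) * H (uV₂ w - uV₁ w)) := by
  have hHc : Continuous H := continuous_iff_continuousAt.2 fun t => (hH t).continuousAt
  have hu₁ : ∀ e, ContinuousOn (u₁ e) (Icc 0 (G.len e)) :=
    fun e => (h₁.2.1.1 e).continuousOn (G.len_pos e)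
  have hu₂ : ∀ e, ContinuousOn (u₂ e) (Icc 0 (G.len e)) :=
    fun e => (h₂.2.1.1 e).continuousOn (G.len_pos e)
  have hφc : ∀ e, ContinuousOn (fun x => H (u₂ e x - u₁ e x)) (Icc 0 (G.len e)) :=
    fun e => hHc.comp_continuousOn ((hu₂ e).sub (hu₁ e))
  have hφc' : ∀ e, ContinuousOn (fun x => H' (u₂ e x - u₁ e x) * (u₂' e x - u₁' e x))
      (Icc 0 (G.len e)) :=
    fun e => (hH'.comp_continuousOn ((hu₂ e).sub (hu₁ e))).mul ((hc₂ e).sub (hc₁ e))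
  have hφ : GraphSobolev G p (fun e x => H (u₂ e x - u₁ e x))
      (fun e x => H' (u₂ e x - u₁ e x) * (u₂' e x - u₁' e x))
      (fun w => H (uV₂ w - uV₁ w)) := by
    refine ⟨fun e => .of_hasDerivAt (by linarith [hp e]) (hφc e) (hφc' e) fun x hx => ?_,
      fun e => ?_, fun e => ?_⟩
    · exact (hH _).comp x (((h₂.2.1.1 e).hasDerivAt (hc₂ e) hx).sub
        ((h₁.2.1.1 e).hasDerivAt (hc₁ e) hx))
    · simp only [h₁.2.1.2.1 e, h₂.2.1.2.1 e]
    · simp only [h₁.2.1.2.2 e, h₂.2.1.2.2 e]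
  have e₁ := h₁.2.2.2 _ _ _ hφ
  have e₂ := h₂.2.2.2 _ _ _ hφ
  simp only [setIntegral_Ioo_eq_intervalIntegral (G.len_pos _)] at e₁ e₂
  have hsplit : ∀ e, (∫ x in (0:ℝ)..G.len e,
      ((γ e (u₂ e x) - γ e (u₁ e x)) * H (u₂ e x - u₁ e x)
        + (rho (p e) (u₂' e x) - rho (p e) (u₁' e x))
          * (H' (u₂ e x - u₁ e x) * (u₂' e x - u₁' e x))))
      = ((∫ x in (0:ℝ)..G.len e, γ e (u₂ e x) * H (u₂ e x - u₁ e x))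
        - ∫ x in (0:ℝ)..G.len e, γ e (u₁ e x) * H (u₂ e x - u₁ e x))
        + ((∫ x in (0:ℝ)..G.len e, rho (p e) (u₂' e x)
            * (H' (u₂ e x - u₁ e x) * (u₂' e x - u₁' e x)))
          - ∫ x in (0:ℝ)..G.len e, rho (p e) (u₁' e x)
            * (H' (u₂ e x - u₁ e x) * (u₂' e x - u₁' e x))) := by
    intro e
    have hℓ := (G.len_pos e).le
    have i₁ := (((hγ e).comp_continuousOn (hu₁ e)).mul (hφc e)).intervalIntegrable_of_Icc
      (μ := volume) hℓ
    have i₂ := (((hγ e).comp_continuousOn (hu₂ e)).mul (hφc e)).intervalIntegrable_of_Icc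
      (μ := volume) hℓ
    have j₁ := (((continuous_rho (hp e)).comp_continuousOn (hc₁ e)).mul
      (hφc' e)).intervalIntegrable_of_Icc (μ := volume) hℓ
    have j₂ := (((continuous_rho (hp e)).comp_continuousOn (hc₂ e)).mul
      (hφc' e)).intervalIntegrable_of_Icc (μ := volume) hℓ
    have hi := intervalIntegral.integral_sub i₂ i₁
    have hj := intervalIntegral.integral_sub j₂ j₁
    have hij := intervalIntegral.integral_add (i₂.sub i₁) (j₂.sub j₁)
    rw [hi, hj] at hij
    simp only [sub_mul]
    exact hij
  simp only [hsplit]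
  simp only [edgeSum, vertexSum, sub_mul, Finset.sum_add_distrib, Finset.sum_sub_distrib]
    at e₁ e₂ ⊢
  linarith

theorem vertexSum_eq_of_forall_ne {G : MetricGraph} {F : G.V → ℝ} (v₀ : G.V)
    (h : ∀ w, w ≠ v₀ → F w = 0) : vertexSum G F = F v₀ := by
  let _ := G.fintypeV
  exact Finset.sum_eq_single v₀ (fun w _ hw => h w hw) (fun hn => absurd (Finset.mem_univ _) hn)

theorem hasDerivAt_sq_max_zero (t : ℝ) :
    HasDerivAt (fun s : ℝ => (max s 0) ^ 2) (2 * max t 0) t := by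
  rcases lt_trichotomy t 0 with h | rfl | h
  · rw [max_eq_right h.le, mul_zero]
    refine (hasDerivAt_const t (0 : ℝ)).congr_of_eventuallyEq ?_
    filter_upwards [gt_mem_nhds h] with s hs
    simp [max_eq_right (le_of_lt hs)]
  · rw [max_self, mul_zero, hasDerivAt_iff_isLittleO_nhds_zero]
    have hO : (fun s : ℝ => (max (0 + s) 0) ^ 2 - (max 0 0) ^ 2 - s • (0 : ℝ))
        =O[nhds 0] fun s : ℝ => s ^ 2 := by
      refine Asymptotics.isBigO_of_le _ fun s => ?_
      rcases le_total s 0 with hs | hs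
      · simp [max_eq_right hs, sq_nonneg]
      · simp [max_eq_left hs]
    exact hO.trans_isLittleO (by simpa using Asymptotics.isLittleO_pow_id one_lt_two)
  · rw [max_eq_left h.le]
    have hd : HasDerivAt (fun s : ℝ => s ^ 2) (2 * t) t := by simpa using hasDerivAt_pow 2 t
    refine hd.congr_of_eventuallyEq ?_
    filter_upwards [lt_mem_nhds h] with s hs
    simp [max_eq_left (le_of_lt hs)]

/-- A vertex is incident to some edge as soon as a solution exists with nonzero flux there. -/
theorem SolvesGraphProblem.exists_incident_edge {G : MetricGraph} {p : G.E → ℝ}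
    (hp : ∀ e, 1 < p e) {γ : G.E → ℝ → ℝ} {f : G.E → ℝ → ℝ} {ω : G.V → ℝ}
    {v u u' : G.E → ℝ → ℝ} {uV : G.V → ℝ} (h : SolvesGraphProblem G p γ f ω v u u' uV)
    {v₀ : G.V} (hω : ω v₀ ≠ 0) : ∃ e, G.ι e = v₀ ∨ G.τ e = v₀ := by
  classical
  by_contra! hno
  have hφ : GraphSobolev G p (fun _ _ => 0) (fun _ _ => 0) (Pi.single v₀ 1) := by
    refine ⟨fun e => .of_hasDerivAt (by linarith [hp e]) continuousOn_const continuousOn_const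
      fun x _ => hasDerivAt_const x 0, fun e => ?_, fun e => ?_⟩
    · simp [(hno e).1]
    · simp [(hno e).2]
  have htest := h.2.2.2 _ _ _ hφ
  rw [vertexSum_eq_of_forall_ne v₀ (fun w hw => by simp [hw])] at htest
  simp [edgeSum] at htest
  exact hω htest.symm

/-- Comparison principle: if testing with the squared positive part of the difference gives a
nonpositive right-hand side, the solutions are ordered. -/
theorem SolvesGraphProblem.le_of_tested_nonpos {G : MetricGraph} {p : G.E → ℝ}
    (hp : ∀ e, 1 < p e) {γ : G.E → ℝ → ℝ} (hγ : ∀ e, Continuous (γ e))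
    (hγm : ∀ e, StrictMono (γ e)) {f : G.E → ℝ → ℝ} {ω₁ ω₂ : G.V → ℝ}
    {u₁ u₁' u₂ u₂' : G.E → ℝ → ℝ} {uV₁ uV₂ : G.V → ℝ}
    (h₁ : SolvesGraphProblem G p γ f ω₁ (fun e x => γ e (u₁ e x)) u₁ u₁' uV₁)
    (h₂ : SolvesGraphProblem G p γ f ω₂ (fun e x => γ e (u₂ e x)) u₂ u₂' uV₂)
    (hc₁ : ∀ e, ContinuousOn (u₁' e) (Icc 0 (G.len e)))
    (hc₂ : ∀ e, ContinuousOn (u₂' e) (Icc 0 (G.len e)))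
    (hω : vertexSum G (fun w => (ω₂ w - ω₁ w) * (max (uV₂ w - uV₁ w) 0) ^ 2) ≤ 0) :
    ∀ e, ∀ x ∈ Icc (0:ℝ) (G.len e), u₂ e x ≤ u₁ e x := by
  let _ := G.fintypeE
  intro e x hx
  by_contra! hlt
  refine hω.not_gt ?_
  have hH' : Continuous fun t : ℝ => 2 * max t 0 := by fun_prop
  rw [← h₁.sub_tested hp hγ h₂ hc₁ hc₂ hasDerivAt_sq_max_zero hH']
  have hγnn : ∀ e x, 0 ≤ (γ e (u₂ e x) - γ e (u₁ e x)) * (max (u₂ e x - u₁ e x) 0) ^ 2 := by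
    intro e x
    rcases le_total (u₂ e x) (u₁ e x) with h | h
    · simp [max_eq_right (sub_nonpos.2 h)]
    · exact mul_nonneg (sub_nonneg.2 ((hγm e).monotone h)) (sq_nonneg _)
  have hρnn : ∀ e x, 0 ≤ (rho (p e) (u₂' e x) - rho (p e) (u₁' e x))
      * (2 * max (u₂ e x - u₁ e x) 0 * (u₂' e x - u₁' e x)) := by
    intro e x
    have := mul_nonneg (le_max_right (u₂ e x - u₁ e x) 0)
      ((strictMono_rho (hp e)).monotone.sub_mul_sub_nonneg (u₂' e x) (u₁' e x))
    linarith
  refine Finset.sum_pos' (fun e _ => ?_) ⟨e, Finset.mem_univ e, ?_⟩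
  · exact intervalIntegral.integral_nonneg (G.len_pos e).le
      fun x _ => add_nonneg (hγnn e x) (hρnn e x)
  · have hu₁ := (h₁.2.1.1 e).continuousOn (G.len_pos e)
    have hu₂ := (h₂.2.1.1 e).continuousOn (G.len_pos e)
    have hd := hu₂.sub hu₁
    have hmax : Continuous fun t : ℝ => (max t 0) ^ 2 := by fun_prop
    refine intervalIntegral.integral_pos (G.len_pos e) ?_
      (fun x _ => add_nonneg (hγnn e x) (hρnn e x)) ⟨x, hx, ?_⟩
    · exact ((((hγ e).comp_continuousOn hu₂).sub ((hγ e).comp_continuousOn hu₁)).mul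
        (hmax.comp_continuousOn hd)).add
        ((((continuous_rho (hp e)).comp_continuousOn (hc₂ e)).sub
          ((continuous_rho (hp e)).comp_continuousOn (hc₁ e))).mul
          ((hH'.comp_continuousOn hd).mul ((hc₂ e).sub (hc₁ e))))
    · refine add_pos_of_pos_of_nonneg (mul_pos (sub_pos.2 (hγm e hlt)) ?_) (hρnn e x)
      rw [max_eq_left (sub_pos.2 hlt).le]
      exact pow_pos (sub_pos.2 hlt) 2

/-- Stability: at a point of an edge, the difference to a fixed solution is controlled, up to an
arbitrarily small error, by the flux difference tested with the difference of solutions. -/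
theorem SolvesGraphProblem.exists_abs_sub_le_add_flux {G : MetricGraph} {p : G.E → ℝ}
    (hp : ∀ e, 1 < p e) {γ : G.E → ℝ → ℝ} (hγ : ∀ e, Continuous (γ e))
    (hγm : ∀ e, StrictMono (γ e)) {f : G.E → ℝ → ℝ} {ω₁ : G.V → ℝ}
    {u₁ u₁' : G.E → ℝ → ℝ} {uV₁ : G.V → ℝ}
    (h₁ : SolvesGraphProblem G p γ f ω₁ (fun e x => γ e (u₁ e x)) u₁ u₁' uV₁)
    (hc₁ : ∀ e, ContinuousOn (u₁' e) (Icc 0 (G.len e))) (e : G.E) {η : ℝ} (hη : 0 < η) :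
    ∃ C : ℝ, 0 ≤ C ∧ ∀ (ω₂ : G.V → ℝ) (u₂ u₂' : G.E → ℝ → ℝ) (uV₂ : G.V → ℝ),
      SolvesGraphProblem G p γ f ω₂ (fun e x => γ e (u₂ e x)) u₂ u₂' uV₂ →
      (∀ e, ContinuousOn (u₂' e) (Icc 0 (G.len e))) →
      ∀ y ∈ Icc 0 (G.len e), |u₂ e y - u₁ e y| ≤
        η + C * vertexSum G (fun w => (ω₂ w - ω₁ w) * (uV₂ w - uV₁ w)) := by
  let _ := G.fintypeE
  have hℓ := G.len_pos e
  have hu₁ := (h₁.2.1.1 e).continuousOn hℓ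
  set ℓ := G.len e
  have hη' : 0 < η / (1 + ℓ) := by positivity
  obtain ⟨A, hA, hγA⟩ := (hγm e).exists_abs_sub_le (hγ e) (isCompact_Icc.image_of_continuousOn hu₁)
    hη'
  obtain ⟨B, hB, hρB⟩ := (strictMono_rho (hp e)).exists_abs_sub_le (continuous_rho (hp e))
    (isCompact_Icc.image_of_continuousOn (hc₁ e)) hη'
  refine ⟨(A + ℓ * B) / ℓ, by positivity, fun ω₂ u₂ u₂' uV₂ h₂ hc₂ y hy => ?_⟩
  have hid := h₁.sub_tested hp hγ h₂ hc₁ hc₂ (H := id) (H' := fun _ => 1) hasDerivAt_id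
    continuous_const
  simp only [id, one_mul] at hid
  have hγnn : ∀ e x, 0 ≤ (γ e (u₂ e x) - γ e (u₁ e x)) * (u₂ e x - u₁ e x) :=
    fun e x => (hγm e).monotone.sub_mul_sub_nonneg _ _
  have hρnn : ∀ e x, 0 ≤ (rho (p e) (u₂' e x) - rho (p e) (u₁' e x)) * (u₂' e x - u₁' e x) :=
    fun e x => (strictMono_rho (hp e)).monotone.sub_mul_sub_nonneg _ _
  have hu₂ := (h₂.2.1.1 e).continuousOn hℓ
  set P : ℝ → ℝ := fun x => (γ e (u₂ e x) - γ e (u₁ e x)) * (u₂ e x - u₁ e x)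
    + (rho (p e) (u₂' e x) - rho (p e) (u₁' e x)) * (u₂' e x - u₁' e x) with hP
  have hPc : ContinuousOn P (Icc 0 ℓ) :=
    ((((hγ e).comp_continuousOn hu₂).sub ((hγ e).comp_continuousOn hu₁)).mul (hu₂.sub hu₁)).add
      ((((continuous_rho (hp e)).comp_continuousOn (hc₂ e)).sub
        ((continuous_rho (hp e)).comp_continuousOn (hc₁ e))).mul ((hc₂ e).sub (hc₁ e)))
  have hPi : IntervalIntegrable P volume 0 ℓ := hPc.intervalIntegrable_of_Icc hℓ.le
  have hPle : ∫ x in (0:ℝ)..ℓ, P x ≤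
      vertexSum G (fun w => (ω₂ w - ω₁ w) * (uV₂ w - uV₁ w)) := by
    rw [← hid]
    exact Finset.single_le_sum (f := fun e => ∫ x in (0:ℝ)..G.len e,
        ((γ e (u₂ e x) - γ e (u₁ e x)) * (u₂ e x - u₁ e x)
        + (rho (p e) (u₂' e x) - rho (p e) (u₁' e x)) * (u₂' e x - u₁' e x)))
      (fun e _ => intervalIntegral.integral_nonneg (G.len_pos e).le
        fun x _ => add_nonneg (hγnn e x) (hρnn e x)) (Finset.mem_univ e)
  have hsob : IntervalSobolev ℓ (p e) (fun x => u₂ e x - u₁ e x) (fun x => u₂' e x - u₁' e x) :=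
    .of_hasDerivAt (by linarith [hp e]) (hu₂.sub hu₁) ((hc₂ e).sub (hc₁ e)) fun x hx =>
      ((h₂.2.1.1 e).hasDerivAt (hc₂ e) hx).sub ((h₁.2.1.1 e).hasDerivAt (hc₁ e) hx)
  have hsobolev := hsob.length_mul_abs_le hℓ ((hc₂ e).sub (hc₁ e)) hy
  have hbound : ∫ x in (0:ℝ)..ℓ, (|u₂ e x - u₁ e x| + ℓ * |u₂' e x - u₁' e x|)
      ≤ ∫ x in (0:ℝ)..ℓ, (η + (A + ℓ * B) * P x) := by
    refine intervalIntegral.integral_mono_on hℓ.le ?_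
      (intervalIntegrable_const.add (hPi.const_mul _)) fun x hx => ?_
    · exact ((hu₂.sub hu₁).abs.add (continuousOn_const.mul
        ((hc₂ e).sub (hc₁ e)).abs)).intervalIntegrable_of_Icc hℓ.le
    · have hd := hγA _ (mem_image_of_mem _ hx) (u₂ e x)
      have hd' := mul_le_mul_of_nonneg_left
        (hρB _ (mem_image_of_mem _ hx) (u₂' e x)) hℓ.le
      have hsum : η / (1 + ℓ) + ℓ * (η / (1 + ℓ)) = η := by field_simp
      have hx₁ := mul_nonneg hA (hρnn e x)
      have hx₂ := mul_nonneg (mul_nonneg hℓ.le hB) (hγnn e x)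
      simp only [hP]
      linarith
  rw [intervalIntegral.integral_add intervalIntegrable_const (hPi.const_mul _),
    intervalIntegral.integral_const, intervalIntegral.integral_const_mul, smul_eq_mul,
    sub_zero] at hbound
  have hfin := mul_le_mul_of_nonneg_left hPle (by positivity : 0 ≤ A + ℓ * B)
  refine le_of_mul_le_mul_left ?_ hℓ
  calc ℓ * |u₂ e y - u₁ e y|
      ≤ ℓ * η + (A + ℓ * B) * vertexSum G (fun w => (ω₂ w - ω₁ w) * (uV₂ w - uV₁ w)) := by
        linarith
    _ = _ := by field_simp

/-- Lemma 3.3: perturbing the flux at a single vertex v₀ by ε moves the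
solution monotonically, and the vertex value ε ↦ u_ε(v₀) is strictly increasing and
continuous. -/
theorem graph_single_vertex_flux_perturbation
    (G : MetricGraph) (p : G.E → ℝ) (hp : ∀ e, 1 < p e)
    (γ : G.E → ℝ → ℝ)
    (hγ : ∀ e, Continuous (γ e) ∧ StrictMono (γ e) ∧ Function.Surjective (γ e) ∧ γ e 0 = 0)
    (f : G.E → ℝ → ℝ) (hf : ∀ e, IntegrableOn (f e) (Ioo 0 (G.len e)) volume)
    (ω : G.V → ℝ) (v₀ : G.V)
    (ωε : ℝ → G.V → ℝ)
    (hωε : ∀ ε : ℝ, ωε ε v₀ = ω v₀ + ε ∧ ∀ w : G.V, w ≠ v₀ → ωε ε w = ω w)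
    (u u' : ℝ → G.E → ℝ → ℝ) (uV : ℝ → G.V → ℝ)
    (hsol : ∀ ε : ℝ, SolvesGraphProblem G p γ f (ωε ε)
      (fun e x => γ e (u ε e x)) (u ε) (u' ε) (uV ε))
    (hC1 : ∀ ε : ℝ, ∀ e, ContinuousOn (u' ε e) (Icc 0 (G.len e))) :
    (∀ ε : ℝ, 0 ≤ ε → ∀ e, ∀ x ∈ Icc (0:ℝ) (G.len e), u 0 e x ≤ u ε e x) ∧
    (∀ ε : ℝ, ε ≤ 0 → ∀ e, ∀ x ∈ Icc (0:ℝ) (G.len e), u ε e x ≤ u 0 e x) ∧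
    StrictMono (fun ε => uV ε v₀) ∧
    Continuous (fun ε => uV ε v₀) := by
  have hγc : ∀ e, Continuous (γ e) := fun e => (hγ e).1
  have hγm : ∀ e, StrictMono (γ e) := fun e => (hγ e).2.1
  have hflux : ∀ (a b : ℝ) (F : G.V → ℝ),
      vertexSum G (fun w => (ωε b w - ωε a w) * F w) = (b - a) * F v₀ := by
    intro a b F
    rw [vertexSum_eq_of_forall_ne v₀ (fun w hw => by
      rw [(hωε a).2 w hw, (hωε b).2 w hw, sub_self, zero_mul]), (hωε a).1, (hωε b).1]
    ring
  have hle : ∀ a b : ℝ, (b - a) * (max (uV b v₀ - uV a v₀) 0) ^ 2 ≤ 0 →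
      ∀ e, ∀ x ∈ Icc (0:ℝ) (G.len e), u b e x ≤ u a e x := fun a b h =>
    (hsol a).le_of_tested_nonpos hp hγc hγm (hsol b) (hC1 a) (hC1 b)
      (by rw [hflux a b fun w => (max (uV b w - uV a w) 0) ^ 2]; exact h)
  have hmono : ∀ a b : ℝ, a ≤ b → ∀ e, ∀ x ∈ Icc (0:ℝ) (G.len e), u a e x ≤ u b e x :=
    fun a b hab => hle b a (mul_nonpos_of_nonpos_of_nonneg (by linarith) (sq_nonneg _))
  obtain ⟨e, he⟩ : ∃ e, G.ι e = v₀ ∨ G.τ e = v₀ :=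
    (hsol (1 - ω v₀)).exists_incident_edge hp (by rw [(hωε _).1]; simp)
  obtain ⟨y, hy, huy⟩ : ∃ y ∈ Icc 0 (G.len e), ∀ ε, uV ε v₀ = u ε e y := by
    rcases he with rfl | rfl
    · exact ⟨0, left_mem_Icc.2 (G.len_pos e).le, fun ε => ((hsol ε).2.1.2.1 e).symm⟩
    · exact ⟨G.len e, right_mem_Icc.2 (G.len_pos e).le, fun ε => ((hsol ε).2.1.2.2 e).symm⟩
  refine ⟨fun ε => hmono 0 ε, fun ε => hmono ε 0, fun a b hab => ?_, ?_⟩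
  · by_contra hlt
    have hba := hle a b (by rw [max_eq_right (by simpa using hlt)]; simp)
    have htest := (hsol a).sub_tested hp hγc (hsol b) (hC1 a) (hC1 b)
      (H := fun _ => 1) (H' := fun _ => 0) (fun t => hasDerivAt_const t 1) continuous_const
    rw [hflux a b fun _ => 1] at htest
    have hzero : ∀ e, (∫ x in (0:ℝ)..G.len e, ((γ e (u b e x) - γ e (u a e x)) * 1
        + (rho (p e) (u' b e x) - rho (p e) (u' a e x))
          * (0 * (u' b e x - u' a e x)))) = 0 := by
      intro e
      refine (intervalIntegral.integral_congr (g := fun _ => (0 : ℝ)) fun x hx => ?_).trans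
        intervalIntegral.integral_zero
      rw [uIcc_of_le (G.len_pos e).le] at hx
      simp [le_antisymm (hba e x hx) (hmono a b hab.le e x hx)]
    simp only [hzero] at htest
    simp [edgeSum] at htest
    linarith
  · refine Metric.continuous_iff.2 fun a δ hδ => ?_
    obtain ⟨C, hC, hbound⟩ := (hsol a).exists_abs_sub_le_add_flux hp hγc hγm (hC1 a) e
      (by positivity : 0 < δ / 4)
    refine ⟨1 / (2 * (C + 1)), by positivity, fun b hb => ?_⟩
    have h := hbound _ _ _ _ (hsol b) (hC1 b) y hy
    rw [hflux a b fun w => uV b w - uV a w, ← huy, ← huy] at h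
    rw [Real.dist_eq] at hb ⊢
    have hsmall : C * |b - a| ≤ 1 / 2 := by
      rw [lt_div_iff₀ (by positivity)] at hb
      nlinarith [abs_nonneg (b - a)]
    have hprod : C * ((b - a) * (uV b v₀ - uV a v₀)) ≤ 1 / 2 * |uV b v₀ - uV a v₀| := by
      calc C * ((b - a) * (uV b v₀ - uV a v₀))
          ≤ C * (|b - a| * |uV b v₀ - uV a v₀|) := by
            rw [← abs_mul]
            exact mul_le_mul_of_nonneg_left (le_abs_self _) hC
        _ = C * |b - a| * |uV b v₀ - uV a v₀| := by ring
        _ ≤ _ := mul_le_mul_of_nonneg_right hsmall (abs_nonneg _)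
    linarith
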